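/- Let N ∈ ℕ with N ≡ 0 or 3 (mod 4), let d be the discriminant of ℚ(√−N), let q be a prime, and set μ_q = ord_q(N) − 2·δ_{q=2}·δ_{d≡0 (mod 4)}. Then H(N) = H(N·q^{−2⌊μ_q/2⌋}) · (q^{⌊μ_q/2⌋+1} − 1 − ((−N·q^{−2⌊μ_q/2⌋})/q)·(q^{⌊μ_q/2⌋} − 1))/(q − 1), where (·/q) is the Kronecker symbol. -/

import Mathlib

open scoped BigOperators Classical
open Matrix Filter

noncomputable section

/-! ## Binary quadratic forms, class numbers, and Hurwitz class numbers -/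

/-- `(a,b,c)` represents the primitive positive-definite binary quadratic form
`a x² + b x y + c y²` of discriminant `d`. -/
def IsPrimPosDefBQF (d : ℤ) (f : ℤ × ℤ × ℤ) : Prop :=
  f.2.1 ^ 2 - 4 * f.1 * f.2.2 = d ∧ Int.gcd f.1 (Int.gcd f.2.1 f.2.2) = 1 ∧ 0 < f.1

/-- `SL₂(ℤ)`-equivalence of binary quadratic forms. -/
def BQFEquiv (f g : ℤ × ℤ × ℤ) : Prop :=
  ∃ M : Matrix.SpecialLinearGroup (Fin 2) ℤ,
    g.1 = f.1 * M 0 0 ^ 2 + f.2.1 * M 0 0 * M 1 0 + f.2.2 * M 1 0 ^ 2 ∧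
    g.2.1 = 2 * f.1 * M 0 0 * M 0 1 + f.2.1 * (M 0 0 * M 1 1 + M 0 1 * M 1 0) +
        2 * f.2.2 * M 1 0 * M 1 1 ∧
    g.2.2 = f.1 * M 0 1 ^ 2 + f.2.1 * M 0 1 * M 1 1 + f.2.2 * M 1 1 ^ 2

/-- The class number `h(d)`: the number of `SL₂(ℤ)`-classes of primitive positive-definite
binary quadratic forms of discriminant `d`. -/
def classNum (d : ℤ) : ℕ :=
  Nat.card (Quot fun f g : {f : ℤ × ℤ × ℤ // IsPrimPosDefBQF d f} => BQFEquiv f.1 g.1)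

/-- The number of automorphs `w_d`. -/
def wAut (d : ℤ) : ℕ := if d = -3 then 6 else if d = -4 then 4 else 2

def hurwitzNat (N : ℕ) : ℚ :=
  if 0 < N ∧ (N % 4 = 0 ∨ N % 4 = 3) then
    ∑ f ∈ N.divisors.filter fun f => f ^ 2 ∣ N,
      (classNum (-((N / f ^ 2 : ℕ) : ℤ)) : ℚ) / ((wAut (-((N / f ^ 2 : ℕ) : ℤ)) : ℚ) / 2)
  else 0

/-- Hurwitz class number, with the convention `H(x) = 0` unless `x` is a positive integer
congruent to `0` or `3 (mod 4)`. -/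
def hurwitz (x : ℚ) : ℚ := if x.den = 1 ∧ 0 ≤ x.num then hurwitzNat x.num.toNat else 0

/-! ## Kronecker symbol and fundamental discriminants -/

def kron2 (a : ℤ) : ℤ := if a % 2 = 0 then 0 else if a % 8 = 1 ∨ a % 8 = 7 then 1 else -1

/-- The Kronecker symbol `(a / n)` for `n ∈ ℕ`. -/
def kroneckerSym (a : ℤ) (n : ℕ) : ℤ :=
  kron2 a ^ padicValNat 2 n * jacobiSym a (n / 2 ^ padicValNat 2 n)

/-- Fundamental discriminants. -/
def IsFundamentalDisc (d : ℤ) : Prop :=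
  d % 4 = 1 ∧ Squarefree d ∨ d % 4 = 0 ∧ Squarefree (d / 4) ∧ (d / 4 % 4 = 2 ∨ d / 4 % 4 = 3)

/-! ## Ternary quadratic lattices via Gram matrices -/

abbrev TernMat := Matrix (Fin 3) (Fin 3) ℤ

/-- The quadratic form attached to a Gram matrix. -/
def quadVal {R : Type*} [CommRing R] {k : ℕ} (M : Matrix (Fin k) (Fin k) R) (x : Fin k → R) : R :=
  ∑ i, ∑ j, x i * M i j * x j

/-- `A` is the Gram matrix of a positive-definite integral ternary lattice. -/
def IsLat (A : TernMat) : Prop := A.IsSymm ∧ ∀ x : Fin 3 → ℤ, x ≠ 0 → 0 < quadVal A x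

/-- The number of representations of `n` by the lattice with Gram matrix `A`. -/
def rRep (n : ℤ) (A : TernMat) : ℕ := Nat.card {x : Fin 3 → ℤ // quadVal A x = n}

/-- Isometry of ternary lattices via their Gram matrices. -/
def LatIsom (A B : TernMat) : Prop := ∃ U : TernMat, IsUnit U.det ∧ Uᵀ * A * U = B

/-- The number of automorphs `o(L)`. -/
def numAut (A : TernMat) : ℕ := Nat.card {U : TernMat // IsUnit U.det ∧ Uᵀ * A * U = A}

def padicMat (p : ℕ) [Fact p.Prime] {k : ℕ} (A : Matrix (Fin k) (Fin k) ℤ) :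
    Matrix (Fin k) (Fin k) ℤ_[p] := A.map Int.cast

/-- Isometry of `ℤ_p`-lattices given by Gram matrices. -/
def PadicIsomP (p : ℕ) [Fact p.Prime] {k : ℕ} (M N : Matrix (Fin k) (Fin k) ℤ_[p]) : Prop :=
  ∃ U : Matrix (Fin k) (Fin k) ℤ_[p], IsUnit U.det ∧ Uᵀ * M * U = N

/-- `A ⊗ ℤ_p ≅ B ⊗ ℤ_p`. -/
def PadicLatIsom (p : ℕ) (hp : p.Prime) (A B : TernMat) : Prop :=
  letI : Fact p.Prime := ⟨hp⟩
  PadicIsomP p (padicMat p A) (padicMat p B)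

/-- `B` is (the Gram matrix of a lattice) in the genus of `A`. -/
def InGenus (A B : TernMat) : Prop :=
  IsLat B ∧ ∀ (p : ℕ) (hp : p.Prime), PadicLatIsom p hp A B

/-- The mass `w(L)` of the genus of `A`. -/
def massOf (A : TernMat) : ℝ :=
  ∑ᶠ c : Quot fun B C : {B : TernMat // InGenus A B} => LatIsom B.1 C.1,
    ((numAut (Quot.out c).1 : ℝ))⁻¹

/-- The Siegel–Weil average `r(n, gen(L))`. -/
def rGenus (n : ℤ) (A : TernMat) : ℝ :=
  (massOf A)⁻¹ *
    ∑ᶠ c : Quot fun B C : {B : TernMat // InGenus A B} => LatIsom B.1 C.1,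
      (rRep n (Quot.out c).1 : ℝ) / (numAut (Quot.out c).1 : ℝ)

/-! ## Local invariants -/

/-- `L_p` is isotropic. -/
def IsotropicP (p : ℕ) [Fact p.Prime] (A : TernMat) : Prop :=
  ∃ x : Fin 3 → ℤ_[p], x ≠ 0 ∧ quadVal (padicMat p A) x = 0

/-- The modified Hasse symbol `S_p*(L)`: `1` if `L_p` is isotropic, `-1` if anisotropic. -/
def SpStar (p : ℕ) (A : TernMat) : ℤ :=
  if h : p.Prime then
    letI : Fact p.Prime := ⟨h⟩
    if IsotropicP p A then 1 else -1
  else 1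

/-- The lattice is even: all represented numbers are even. -/
def IsEvenLat (A : TernMat) : Prop := ∀ x : Fin 3 → ℤ, 2 ∣ quadVal A x

/-- The lattice is primitive: its scale ideal is `ℤ`. -/
def IsPrimitiveLat (A : TernMat) : Prop :=
  Finset.univ.gcd (fun ij : Fin 3 × Fin 3 => (A ij.1 ij.2).natAbs) = 1

/-- Stability at a prime `p`. -/
def StableAt (A : TernMat) (p : ℕ) : Prop :=
  padicValInt p A.det ≤ 1 ∧ (p = 2 → (padicValInt 2 A.det = 1 ↔ IsEvenLat A))

/-- A stable (primitive) ternary lattice. -/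
def IsStable (A : TernMat) : Prop := IsPrimitiveLat A ∧ ∀ p : ℕ, p.Prime → StableAt A p

def RepresentedAt (p : ℕ) (hp : p.Prime) (n : ℤ) (A : TernMat) : Prop :=
  letI : Fact p.Prime := ⟨hp⟩
  ∃ x : Fin 3 → ℤ_[p], quadVal (padicMat p A) x = (n : ℤ_[p])

/-- `n` is represented by `L_p` for every prime `p`. -/
def LocallyRepresented (n : ℤ) (A : TernMat) : Prop :=
  ∀ (p : ℕ) (hp : p.Prime), RepresentedAt p hp n A

/-! ## Siegel local densities -/

/-- The Siegel local density `α_p(n, L)` (here `s = 1`, `t = 3`). -/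
def localDensity (p : ℕ) (hp : p.Prime) (n : ℤ) (A : TernMat) : ℝ :=
  limUnder atTop fun r : ℕ =>
    (Nat.card {X : Fin 3 → ZMod (p ^ r) //
        (∑ i, ∑ j, X i * (A i j : ZMod (p ^ r)) * X j) = (n : ZMod (p ^ r))} : ℝ) /
      (p : ℝ) ^ (2 * r)

def localDensityN (p : ℕ) (n : ℤ) (A : TernMat) : ℝ :=
  if h : p.Prime then localDensity p h n A else 0

/-- The value `L(1, χ_a)` of the Dirichlet series attached to the Kronecker symbol `(a/·)`. -/
def LOne (a : ℤ) : ℝ :=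
  limUnder atTop fun N : ℕ =>
    ∑ k ∈ Finset.range N, (kroneckerSym a (k + 1) : ℝ) / (k + 1)

/-! ## Watson transformations (Gram matrix form) -/

/-- The underlying set of `Λ_m(L)` in the coordinates of `L`. -/
def watsonSetG (m : ℕ) (A : TernMat) : Set (Fin 3 → ℤ) :=
  {x | ∀ y : Fin 3 → ℤ, (m : ℤ) ∣ (quadVal A (x + y) - quadVal A y)}

/-- `B` is a Gram matrix for the sublattice `Λ_m(L)` of the lattice `L` with Gram matrix `A`. -/
def IsWatsonGram (m : ℕ) (A B : TernMat) : Prop :=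
  ∃ T : TernMat, Set.range T.mulVec = watsonSetG m A ∧ B = Tᵀ * A * T

/-- `B` is a Gram matrix of the Watson transform `λ_m(L)`: the primitive rescaling of `Λ_m(L)`. -/
def IsLambdaGram (m : ℕ) (A B : TernMat) : Prop :=
  IsPrimitiveLat B ∧
    ∃ (B₀ : TernMat) (c : ℚ), 0 < c ∧ IsWatsonGram m A B₀ ∧
      B.map ((↑) : ℤ → ℚ) = c • B₀.map ((↑) : ℤ → ℚ)

/-- The `3×3` Gram matrix of the orthogonal sum `M ⊥ U`. -/
def blockMat3 {p : ℕ} [Fact p.Prime] (k : ℕ) (hk : k ≤ 3)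
    (M : Matrix (Fin k) (Fin k) ℤ_[p]) (U : Matrix (Fin (3 - k)) (Fin (3 - k)) ℤ_[p]) :
    Matrix (Fin 3) (Fin 3) ℤ_[p] :=
  Matrix.reindex (finSumFinEquiv.trans (finCongr (by omega)))
    (finSumFinEquiv.trans (finCongr (by omega))) (Matrix.fromBlocks M 0 0 U)

end
/-! ## Helper lemmas -/

namespace HRed

/-- The right action of integer matrices on forms. -/
def qact (f : ℤ × ℤ × ℤ) (M : Matrix (Fin 2) (Fin 2) ℤ) : ℤ × ℤ × ℤ :=
  (f.1 * M 0 0 ^ 2 + f.2.1 * M 0 0 * M 1 0 + f.2.2 * M 1 0 ^ 2,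
   2 * f.1 * M 0 0 * M 0 1 + f.2.1 * (M 0 0 * M 1 1 + M 0 1 * M 1 0) +
        2 * f.2.2 * M 1 0 * M 1 1,
   f.1 * M 0 1 ^ 2 + f.2.1 * M 0 1 * M 1 1 + f.2.2 * M 1 1 ^ 2)

abbrev SL := Matrix.SpecialLinearGroup (Fin 2) ℤ

theorem equiv_iff (f g : ℤ × ℤ × ℤ) : BQFEquiv f g ↔ ∃ M : SL, qact f M.1 = g := by
  constructor
  · rintro ⟨M, h1, h2, h3⟩
    exact ⟨M, Prod.ext h1.symm (Prod.ext h2.symm h3.symm)⟩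
  · rintro ⟨M, rfl⟩
    exact ⟨M, rfl, rfl, rfl⟩

theorem qact_mul (f : ℤ × ℤ × ℤ) (M N : Matrix (Fin 2) (Fin 2) ℤ) :
    qact (qact f M) N = qact f (M * N) := by
  refine Prod.ext ?_ (Prod.ext ?_ ?_) <;>
  · simp only [qact, Matrix.mul_apply, Fin.sum_univ_two]
    ring

theorem qact_one (f : ℤ × ℤ × ℤ) : qact f 1 = f := by
  refine Prod.ext ?_ (Prod.ext ?_ ?_) <;> simp [qact]

theorem qact_smul (f : ℤ × ℤ × ℤ) (e : ℤ) :
    qact f (e • (1 : Matrix (Fin 2) (Fin 2) ℤ)) = (e ^ 2 * f.1, e ^ 2 * f.2.1, e ^ 2 * f.2.2) := by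
  refine Prod.ext ?_ (Prod.ext ?_ ?_) <;> simp [qact] <;> ring

theorem qact_inv (f g : ℤ × ℤ × ℤ) (M : SL) (h : qact f M.1 = g) : qact g (M⁻¹).1 = f := by
  rw [← h, qact_mul, ← Matrix.SpecialLinearGroup.coe_mul, mul_inv_cancel]
  exact qact_one f

theorem qact_disc (f : ℤ × ℤ × ℤ) (M : Matrix (Fin 2) (Fin 2) ℤ) :
    (qact f M).2.1 ^ 2 - 4 * (qact f M).1 * (qact f M).2.2
      = M.det ^ 2 * (f.2.1 ^ 2 - 4 * f.1 * f.2.2) := by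
  simp only [qact, Matrix.det_fin_two]; ring

def DvdF (p : ℤ) (f : ℤ × ℤ × ℤ) : Prop := p ∣ f.1 ∧ p ∣ f.2.1 ∧ p ∣ f.2.2

theorem DvdF.act {p : ℤ} {f : ℤ × ℤ × ℤ} (h : DvdF p f) (M : Matrix (Fin 2) (Fin 2) ℤ) :
    DvdF p (qact f M) := by
  obtain ⟨⟨a, ha⟩, ⟨b, hb⟩, ⟨c, hc⟩⟩ := h
  refine ⟨⟨(qact (a, b, c) M).1, ?_⟩, ⟨(qact (a, b, c) M).2.1, ?_⟩,
    ⟨(qact (a, b, c) M).2.2, ?_⟩⟩ <;>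
  · simp only [qact, ha, hb, hc]; ring

theorem prim_iff (f : ℤ × ℤ × ℤ) : Int.gcd f.1 (Int.gcd f.2.1 f.2.2) = 1 ↔
    ∀ p : ℕ, p.Prime → ¬ DvdF p f := by
  constructor
  · rintro h p hp ⟨h1, h2, h3⟩
    have : (p : ℤ) ∣ ((Int.gcd f.1 (Int.gcd f.2.1 f.2.2) : ℕ) : ℤ) :=
      Int.dvd_coe_gcd h1 (Int.dvd_coe_gcd h2 h3)
    rw [h] at this
    have h4 : p ∣ 1 := by exact_mod_cast this
    exact hp.one_lt.ne' (Nat.dvd_one.mp h4)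
  · intro h
    by_contra hne
    obtain ⟨p, hp, hd⟩ := Nat.exists_prime_and_dvd hne
    have hd' : (p : ℤ) ∣ ((Int.gcd f.1 (Int.gcd f.2.1 f.2.2) : ℕ) : ℤ) := by exact_mod_cast hd
    have h2 : (p : ℤ) ∣ ((Int.gcd f.2.1 f.2.2 : ℕ) : ℤ) := hd'.trans (Int.gcd_dvd_right _ _)
    exact h p hp ⟨hd'.trans (Int.gcd_dvd_left _ _), h2.trans (Int.gcd_dvd_left _ _),
      h2.trans (Int.gcd_dvd_right _ _)⟩

theorem qact_adj (f : ℤ × ℤ × ℤ) (M : Matrix (Fin 2) (Fin 2) ℤ) :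
    qact (qact f M) M.adjugate = (M.det ^ 2 * f.1, M.det ^ 2 * f.2.1, M.det ^ 2 * f.2.2) := by
  rw [qact_mul, Matrix.mul_adjugate, qact_smul]

theorem qact_cancel {f g : ℤ × ℤ × ℤ} {M : Matrix (Fin 2) (Fin 2) ℤ} (hM : M.det ≠ 0)
    (h : qact f M = qact g M) : f = g := by
  have h1 := qact_adj f M
  rw [h, qact_adj g M] at h1
  have h2 : M.det ^ 2 ≠ 0 := pow_ne_zero _ hM
  simp only [Prod.mk.injEq] at h1
  exact Prod.ext (mul_left_cancel₀ h2 h1.1).symm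
    (Prod.ext (mul_left_cancel₀ h2 h1.2.1).symm (mul_left_cancel₀ h2 h1.2.2).symm)

theorem DvdF.of_act {p : ℕ} (hp : p.Prime) {f : ℤ × ℤ × ℤ} {M : Matrix (Fin 2) (Fin 2) ℤ}
    (hM : ¬ (p : ℤ) ∣ M.det) (h : DvdF p (qact f M)) : DvdF p f := by
  have h1 := h.act M.adjugate
  rw [qact_adj] at h1
  have hp' : Prime (p : ℤ) := Nat.prime_iff_prime_int.mp hp
  have key : ∀ x : ℤ, (p : ℤ) ∣ M.det ^ 2 * x → (p : ℤ) ∣ x := fun x hx =>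
    (hp'.dvd_or_dvd hx).resolve_left fun h => hM (hp'.dvd_of_dvd_pow h)
  exact ⟨key _ h1.1, key _ h1.2.1, key _ h1.2.2⟩

theorem qact_pos {D : ℤ} (hD : D < 0) {f : ℤ × ℤ × ℤ} (hf : IsPrimPosDefBQF D f)
    {M : Matrix (Fin 2) (Fin 2) ℤ} (hM : M.det ≠ 0) : 0 < (qact f M).1 := by
  obtain ⟨h1, -, h3⟩ := hf
  have key : 4 * f.1 * (qact f M).1
      = (2 * f.1 * M 0 0 + f.2.1 * M 1 0) ^ 2 - D * M 1 0 ^ 2 := by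
    rw [← h1]; simp only [qact]; ring
  have hpos : 0 < (2 * f.1 * M 0 0 + f.2.1 * M 1 0) ^ 2 - D * M 1 0 ^ 2 := by
    by_cases h0 : M 1 0 = 0
    · have h00 : M 0 0 ≠ 0 := by
        intro h; apply hM; rw [Matrix.det_fin_two, h, h0]; ring
      rw [h0]
      have : 2 * f.1 * M 0 0 + f.2.1 * 0 ≠ 0 := by
        simp [h00, h3.ne']
      have := pow_pos (abs_pos.mpr this) 2
      rw [sq_abs] at this
      linarith
    · have h4 : 0 < M 1 0 ^ 2 := by positivity
      nlinarith [sq_nonneg (2 * f.1 * M 0 0 + f.2.1 * M 1 0)]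
  rw [← key] at hpos
  exact pos_of_mul_pos_right hpos (by linarith)

theorem prim_act {D : ℤ} (hD : D < 0) {f : ℤ × ℤ × ℤ} (hf : IsPrimPosDefBQF D f) (M : SL) :
    IsPrimPosDefBQF D (qact f M.1) := by
  refine ⟨?_, ?_, qact_pos hD hf (by rw [M.2]; exact one_ne_zero)⟩
  · rw [qact_disc, M.2, hf.1]; ring
  · rw [prim_iff]
    intro p hp h
    refine (prim_iff f).1 hf.2.1 p hp (DvdF.of_act hp ?_ h)
    rw [M.2]
    intro h1
    exact (Nat.prime_iff_prime_int.mp hp).not_dvd_one h1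

/-! ### Stabilisers -/

theorem stab_form {D : ℤ} {f : ℤ × ℤ × ℤ} (hf : IsPrimPosDefBQF D f) (M : SL)
    (h : qact f M.1 = f) : ∃ u : ℤ, M.1 1 0 = f.1 * u ∧ M.1 0 1 = - f.2.2 * u ∧
      M.1 1 1 - M.1 0 0 = f.2.1 * u := by
  obtain ⟨a, b, c⟩ := f
  have hdet := M.2
  rw [Matrix.det_fin_two] at hdet
  obtain ⟨h1, h2, h3⟩ := hf
  simp only [qact, Prod.mk.injEq] at h h1 h2 h3 ⊢
  obtain ⟨e1, e2, e3⟩ := h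
  set x := M.1 0 0
  set y := M.1 0 1
  set z := M.1 1 0
  set w := M.1 1 1
  have k1 : 2 * (a * y) = 2 * (- c * z) := by
    linear_combination w * e2 - 2 * z * e3 - (2 * a * y + b * w) * hdet
  have k2 : 2 * (b * z) = 2 * (a * (w - x)) := by
    linear_combination 2 * w * e1 - z * e2 - (2 * a * x + b * z) * hdet
  have k3 : 2 * (b * y) = 2 * (- c * (w - x)) := by
    linear_combination - y * e2 + 2 * x * e3 - (b * y + 2 * c * w) * hdet
  have k1 := mul_left_cancel₀ (two_ne_zero) k1
  have k2 := mul_left_cancel₀ (two_ne_zero) k2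
  have k3 := mul_left_cancel₀ (two_ne_zero) k3
  obtain ⟨r, s, t, hb⟩ : ∃ r s t : ℤ, r * a + s * b + t * c = 1 := by
    have g1 := Int.gcd_eq_gcd_ab a (Int.gcd b c)
    have g2 := Int.gcd_eq_gcd_ab b c
    rw [h2] at g1
    refine ⟨Int.gcdA a (Int.gcd b c), Int.gcdB a (Int.gcd b c) * Int.gcdA b c,
      Int.gcdB a (Int.gcd b c) * Int.gcdB b c, ?_⟩
    push_cast at g1
    linear_combination -g1 - Int.gcdB a (Int.gcd b c) * g2
  refine ⟨r * z + s * (w - x) - t * y, ?_, ?_, ?_⟩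
  · linear_combination -z * hb + s * k2 + t * k1
  · linear_combination -y * hb + r * k1 + s * k3
  · linear_combination -(w - x) * hb - r * k2 + t * k3

/-- Solutions of the Pell type equation. -/
def Pell (D : ℤ) : Set (ℤ × ℤ) := {p | p.1 ^ 2 - D * p.2 ^ 2 = 4}

theorem stab_card_pell {D : ℤ} {f : ℤ × ℤ × ℤ} (hf : IsPrimPosDefBQF D f) :
    Nat.card {M : SL // qact f M.1 = f} = Nat.card (Pell D) := by
  have ha : f.1 ≠ 0 := hf.2.2.ne'
  have hmem : ∀ M : {M : SL // qact f M.1 = f},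
      (M.1.1 0 0 + M.1.1 1 1, M.1.1 1 0 / f.1) ∈ Pell D := by
    rintro ⟨M, hM⟩
    obtain ⟨u, h1, h2, h3⟩ := stab_form hf M hM
    have hdet := M.2
    rw [Matrix.det_fin_two] at hdet
    simp only [Pell, Set.mem_ofPred_eq]
    rw [h1, Int.mul_ediv_cancel_left _ ha, ← hf.1]
    rw [h1, h2] at hdet
    have h4 : M.1 1 1 = M.1 0 0 + f.2.1 * u := by linarith
    rw [h4] at hdet ⊢
    linear_combination 4 * hdet
  refine Nat.card_congr (Equiv.ofBijective (fun M => (⟨_, hmem M⟩ : Pell D)) ⟨?_, ?_⟩)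
  · rintro ⟨M, hM⟩ ⟨M', hM'⟩ h
    obtain ⟨u, h1, h2, h3⟩ := stab_form hf M hM
    obtain ⟨u', h1', h2', h3'⟩ := stab_form hf M' hM'
    simp only [Subtype.mk.injEq, Prod.mk.injEq] at h
    rw [h1, h1', Int.mul_ediv_cancel_left _ ha, Int.mul_ediv_cancel_left _ ha] at h
    obtain ⟨e1, rfl⟩ := h
    apply Subtype.ext
    apply Subtype.ext
    ext i j
    fin_cases i <;> fin_cases j <;> simp <;> linarith
  · rintro ⟨⟨t, u⟩, ht⟩
    simp only [Pell, Set.mem_ofPred_eq] at ht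
    have hD := hf.1
    obtain ⟨v, hv⟩ : ∃ v, t = f.2.1 * u + 2 * v := by
      have h5 : Even ((t - f.2.1 * u) ^ 2) := by
        refine ⟨2 + f.2.1 ^ 2 * u ^ 2 - 2 * f.1 * f.2.2 * u ^ 2 - t * f.2.1 * u, ?_⟩
        rw [← hD] at ht
        linear_combination ht
      rw [Int.even_pow' (two_ne_zero)] at h5
      obtain ⟨v, hv⟩ := h5
      exact ⟨v, by linarith⟩
    subst hv
    have hdet : Matrix.det !![v, -f.2.2 * u; f.1 * u, v + f.2.1 * u] = 1 := by
      rw [Matrix.det_fin_two_of]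
      rw [← hD] at ht
      have : 4 * (v * (v + f.2.1 * u) - -f.2.2 * u * (f.1 * u)) = 4 * 1 := by
        linear_combination ht
      exact mul_left_cancel₀ (by norm_num) this
    refine ⟨⟨⟨_, hdet⟩, ?_⟩, ?_⟩
    · rw [Matrix.det_fin_two_of] at hdet
      refine Prod.ext ?_ (Prod.ext ?_ ?_)
      · simp only [qact]
        simp
        linear_combination f.1 * hdet
      · simp only [qact]
        simp
        linear_combination f.2.1 * hdet
      · simp only [qact]
        simp
        linear_combination f.2.2 * hdet
    · apply Subtype.ext
      refine Prod.ext ?_ ?_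
      · simp; ring
      · simp [ha]

theorem pell_card {D : ℤ} (hD : D < 0) (hm : D % 4 = 0 ∨ D % 4 = 1) :
    Nat.card (Pell D) = wAut D := by
  have bound : ∀ t u : ℤ, t ^ 2 - D * u ^ 2 = 4 → -2 ≤ t ∧ t ≤ 2 ∧ -1 ≤ u ∧ u ≤ 1 := by
    intro t u h
    have h1 : 0 ≤ (-3 - D) * u ^ 2 := mul_nonneg (by omega) (sq_nonneg _)
    refine ⟨?_, ?_, ?_, ?_⟩ <;> nlinarith [sq_nonneg t, sq_nonneg u]
  by_cases h3 : D = -3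
  · have : Pell D = ↑({(2,0), (-2,0), (1,1), (1,-1), (-1,1), (-1,-1)} : Finset (ℤ × ℤ)) := by
      ext ⟨t, u⟩
      constructor
      · intro h
        have h' : t ^ 2 - D * u ^ 2 = 4 := h
        obtain ⟨b1, b2, b3, b4⟩ := bound t u h'
        subst h3
        interval_cases t <;> interval_cases u <;> simp at h' ⊢
      · intro h
        subst h3
        simp at h
        rcases h with h | h | h | h | h | h <;> obtain ⟨rfl, rfl⟩ := h <;> simp [Pell]
    rw [this, h3]
    simp [wAut]
  by_cases h4 : D = -4
  · have : Pell D = ↑({(2,0), (-2,0), (0,1), (0,-1)} : Finset (ℤ × ℤ)) := by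
      ext ⟨t, u⟩
      constructor
      · intro h
        have h' : t ^ 2 - D * u ^ 2 = 4 := h
        obtain ⟨b1, b2, b3, b4⟩ := bound t u h'
        subst h4
        interval_cases t <;> interval_cases u <;> simp at h' ⊢
      · intro h
        subst h4
        simp at h
        rcases h with h | h | h | h <;> obtain ⟨rfl, rfl⟩ := h <;> simp [Pell]
    rw [this, h4]
    simp [wAut]
  · have : Pell D = ↑({(2,0), (-2,0)} : Finset (ℤ × ℤ)) := by
      ext ⟨t, u⟩
      constructor
      · intro h
        have h' : t ^ 2 - D * u ^ 2 = 4 := h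
        obtain ⟨b1, b2, b3, b4⟩ := bound t u h'
        have : u = 0 := by
          by_contra hu
          have : u ^ 2 = 1 := by
            interval_cases u <;> simp_all
          rw [this] at h'
          have : D ≤ -7 := by omega
          nlinarith [sq_nonneg t]
        subst this
        interval_cases t <;> simp at h' ⊢
      · intro h
        simp at h
        rcases h with h | h <;> obtain ⟨rfl, rfl⟩ := h <;> simp [Pell]
    rw [this]
    simp [wAut, h3, h4]

theorem disc_mod {D : ℤ} {f : ℤ × ℤ × ℤ} (hf : IsPrimPosDefBQF D f) : D % 4 = 0 ∨ D % 4 = 1 := by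
  have h := hf.1
  rcases Int.even_or_odd' f.2.1 with ⟨k, hk | hk⟩ <;> rw [hk] at h
  · left
    have : D = 4 * (k ^ 2 - f.1 * f.2.2) := by rw [← h]; ring
    omega
  · right
    have : D = 4 * (k ^ 2 + k - f.1 * f.2.2) + 1 := by rw [← h]; ring
    omega

theorem transporter_card {D : ℤ} (hD : D < 0) {f g : ℤ × ℤ × ℤ} (hf : IsPrimPosDefBQF D f)
    (M₀ : SL) (h0 : qact f M₀.1 = g) : Nat.card {M : SL // qact f M.1 = g} = wAut D := by
  rw [← pell_card hD (disc_mod hf), ← stab_card_pell hf]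
  have hi := qact_inv _ _ _ h0
  refine Nat.card_congr ⟨fun M => ⟨M.1 * M₀⁻¹, ?_⟩, fun M => ⟨M.1 * M₀, ?_⟩, ?_, ?_⟩
  · rw [Matrix.SpecialLinearGroup.coe_mul, ← qact_mul, M.2, hi]
  · rw [Matrix.SpecialLinearGroup.coe_mul, ← qact_mul, M.2, h0]
  · intro M; simp
  · intro M; simp

theorem fiber_card {A B : Type*} (p : A → B) (n : ℕ) (hn : 0 < n)
    (h : ∀ b, Nat.card {a // p a = b} = n) : Nat.card A = Nat.card B * n := by
  have e : ∀ b, Nonempty ({a // p a = b} ≃ Fin n) := fun b => by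
    rw [← h b]
    exact ⟨Nat.equivFinOfCardPos (by rw [h b]; exact hn.ne')⟩
  have e := fun b => Classical.choice (e b)
  rw [Nat.card_congr ((Equiv.sigmaFiberEquiv p).symm.trans
    ((Equiv.sigmaCongrRight e).trans (Equiv.sigmaEquivProd B (Fin n)))), Nat.card_prod]
  simp

end HRed
namespace HRed

/-! ### Classes and representatives -/

abbrev Cl (D : ℤ) : Type :=
  Quot fun f g : {f : ℤ × ℤ × ℤ // IsPrimPosDefBQF D f} => BQFEquiv f.1 g.1

noncomputable def rep {D : ℤ} (t : Cl D) : ℤ × ℤ × ℤ := (Quot.out t).1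

theorem rep_prim {D : ℤ} (t : Cl D) : IsPrimPosDefBQF D (rep t) := (Quot.out t).2

theorem bqf_equivalence (D : ℤ) : Equivalence
    (fun f g : {f : ℤ × ℤ × ℤ // IsPrimPosDefBQF D f} => BQFEquiv f.1 g.1) where
  refl f := (equiv_iff _ _).2 ⟨1, qact_one _⟩
  symm {f g} h := by
    obtain ⟨M, hM⟩ := (equiv_iff _ _).1 h
    exact (equiv_iff _ _).2 ⟨M⁻¹, qact_inv _ _ _ hM⟩
  trans {f g e} h h' := by
    obtain ⟨M, hM⟩ := (equiv_iff _ _).1 h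
    obtain ⟨M', hM'⟩ := (equiv_iff _ _).1 h'
    refine (equiv_iff _ _).2 ⟨M * M', ?_⟩
    rw [Matrix.SpecialLinearGroup.coe_mul, ← qact_mul, hM, hM']

theorem rep_unique {D : ℤ} (t t' : Cl D) (M : SL) (h : qact (rep t) M.1 = rep t') : t = t' := by
  rw [← Quot.out_eq t, ← Quot.out_eq t']
  exact Quot.sound ((equiv_iff _ _).2 ⟨M, h⟩)

theorem exists_rep {D : ℤ} (f : ℤ × ℤ × ℤ) (hf : IsPrimPosDefBQF D f) :
    ∃ (t : Cl D) (M : SL), qact f M.1 = rep t := by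
  refine ⟨Quot.mk _ ⟨f, hf⟩, ?_⟩
  have h : Quot.mk _ ⟨f, hf⟩ = Quot.mk (fun f g : {f : ℤ × ℤ × ℤ // IsPrimPosDefBQF D f} =>
      BQFEquiv f.1 g.1) (Quot.out (Quot.mk _ ⟨f, hf⟩)) := (Quot.out_eq _).symm
  have h2 := Quot.eqvGen_exact h
  rw [(bqf_equivalence D).eqvGen_iff] at h2
  exact (equiv_iff _ _).1 h2

/-! ### Matrices of determinant `q` -/

def Mi (q : ℕ) : Option (ZMod q) → Matrix (Fin 2) (Fin 2) ℤ
  | none => !![1, 0; 0, (q : ℤ)]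
  | some j => !![(q : ℤ), (j.val : ℤ); 0, 1]

theorem Mi_det (q : ℕ) (i : Option (ZMod q)) : (Mi q i).det = q := by
  cases i <;> simp [Mi, Matrix.det_fin_two_of]

theorem cast_val_eq {q : ℕ} [NeZero q] (j : ZMod q) : (((j.val : ℕ) : ℤ) : ZMod q) = j := by
  simp

theorem hnf_exists (q : ℕ) (hq : q.Prime) (M : Matrix (Fin 2) (Fin 2) ℤ) (hM : M.det = q) :
    ∃ (i : Option (ZMod q)) (γ : SL), M = Mi q i * γ.1 := by
  have : Fact q.Prime := ⟨hq⟩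
  have hq0 : (q : ℤ) ≠ 0 := by exact_mod_cast hq.ne_zero
  have hdet := hM
  rw [Matrix.det_fin_two] at hdet
  have hdetz : (M 0 0 : ZMod q) * M 1 1 - M 0 1 * M 1 0 = 0 := by
    have := congrArg (Int.cast : ℤ → ZMod q) hdet
    push_cast at this
    simpa using this
  by_cases hrow : (M 1 0 : ZMod q) = 0 ∧ (M 1 1 : ZMod q) = 0
  · obtain ⟨c, hc⟩ := (ZMod.intCast_zmod_eq_zero_iff_dvd _ _).1 hrow.1
    obtain ⟨e, he⟩ := (ZMod.intCast_zmod_eq_zero_iff_dvd _ _).1 hrow.2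
    refine ⟨none, ⟨!![M 0 0, M 0 1; c, e], ?_⟩, ?_⟩
    · rw [Matrix.det_fin_two_of]
      apply mul_left_cancel₀ hq0
      rw [hc, he] at hdet
      linear_combination hdet
    · ext i j
      fin_cases i <;> fin_cases j <;> simp [Mi, Matrix.mul_apply, Fin.sum_univ_two, hc, he]
  · obtain ⟨j, hj1, hj2⟩ : ∃ j : ZMod q, (M 0 0 : ZMod q) = j * M 1 0 ∧
        (M 0 1 : ZMod q) = j * M 1 1 := by
      by_cases h0 : (M 1 0 : ZMod q) = 0
      · have h1 : (M 1 1 : ZMod q) ≠ 0 := fun h => hrow ⟨h0, h⟩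
        refine ⟨M 0 1 / M 1 1, ?_, ?_⟩
        · rw [h0] at hdetz ⊢
          have : (M 0 0 : ZMod q) * M 1 1 = 0 := by linear_combination hdetz
          simpa [h1] using this
        · field_simp
      · refine ⟨M 0 0 / M 1 0, ?_, ?_⟩
        · field_simp
        · field_simp
          linear_combination -hdetz
    have d1 : (q : ℤ) ∣ M 0 0 - j.val * M 1 0 := by
      rw [← ZMod.intCast_zmod_eq_zero_iff_dvd]
      push_cast
      simp [hj1]
    have d2 : (q : ℤ) ∣ M 0 1 - j.val * M 1 1 := by
      rw [← ZMod.intCast_zmod_eq_zero_iff_dvd]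
      push_cast
      simp [hj2]
    obtain ⟨c, hc⟩ := d1
    obtain ⟨e, he⟩ := d2
    have hc : M 0 0 = q * c + j.val * M 1 0 := by linarith
    have he : M 0 1 = q * e + j.val * M 1 1 := by linarith
    refine ⟨some j, ⟨!![c, e; M 1 0, M 1 1], ?_⟩, ?_⟩
    · rw [Matrix.det_fin_two_of]
      apply mul_left_cancel₀ hq0
      rw [hc, he] at hdet
      linear_combination hdet
    · ext i j
      fin_cases i <;> fin_cases j <;> simp [Mi, Matrix.mul_apply, Fin.sum_univ_two, hc, he]

theorem hnf_unique (q : ℕ) (hq : q.Prime) (i i' : Option (ZMod q)) (γ γ' : SL)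
    (h : Mi q i * γ.1 = Mi q i' * γ'.1) : i = i' ∧ γ = γ' := by
  have : Fact q.Prime := ⟨hq⟩
  have hq0 : (q : ℤ) ≠ 0 := by exact_mod_cast hq.ne_zero
  have hii : i = i' := by
    have h' : Mi q i * (γ * γ'⁻¹).1 = Mi q i' := by
      rw [Matrix.SpecialLinearGroup.coe_mul, ← mul_assoc, h, mul_assoc,
        ← Matrix.SpecialLinearGroup.coe_mul, mul_inv_cancel, Matrix.SpecialLinearGroup.coe_one,
        mul_one]
    generalize γ * γ'⁻¹ = δ at h'
    have e00 := congrFun (congrFun h' 0) 0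
    have e01 := congrFun (congrFun h' 0) 1
    have e10 := congrFun (congrFun h' 1) 0
    have e11 := congrFun (congrFun h' 1) 1
    have hone : ¬ (q : ℤ) ∣ 1 := (Nat.prime_iff_prime_int.mp hq).not_dvd_one
    have hone' : ∀ x : ℤ, (q : ℤ) * x ≠ 1 := fun x hx => hone ⟨x, hx.symm⟩
    cases i with
    | none =>
      cases i' with
      | none => rfl
      | some j =>
        simp [Mi, Matrix.mul_apply, Fin.sum_univ_two] at e00 e01 e10 e11
        exact absurd e11 (hone' _)
    | some j =>
      cases i' with
      | none =>
        simp [Mi, Matrix.mul_apply, Fin.sum_univ_two] at e00 e01 e10 e11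
        rw [e10] at e00
        exact absurd (by linarith) (hone' (δ.1 0 0))
      | some j' =>
        simp [Mi, Matrix.mul_apply, Fin.sum_univ_two] at e00 e01 e10 e11
        rw [e11] at e01
        have := congrArg (Int.cast : ℤ → ZMod q) e01
        push_cast at this
        simp at this
        rw [this]
  subst hii
  refine ⟨rfl, ?_⟩
  have h2 := congrArg (fun X => (Mi q i).adjugate * X) h
  simp only [← mul_assoc, Matrix.adjugate_mul, Mi_det, smul_mul_assoc, one_mul] at h2
  apply Subtype.ext
  ext a b
  have := congrFun (congrFun h2 a) b
  simp only [Matrix.smul_apply, smul_eq_mul] at this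
  exact mul_left_cancel₀ hq0 this

theorem mul_right_cancel_det {M X Y : Matrix (Fin 2) (Fin 2) ℤ} (hM : M.det ≠ 0)
    (h : X * M = Y * M) : X = Y := by
  have h2 := congrArg (fun Z => Z * M.adjugate) h
  simp only [mul_assoc, Matrix.mul_adjugate, mul_smul_comm, mul_one] at h2
  ext a b
  have := congrFun (congrFun h2 a) b
  simp only [Matrix.smul_apply, smul_eq_mul] at this
  exact mul_left_cancel₀ hM this

/-! ### The overlattice -/

theorem normal_form (q : ℕ) (hq : q.Prime) (D : ℤ) (hm : D % 4 = 0 ∨ D % 4 = 1)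
    (u : ℤ × ℤ × ℤ) (hu : u.2.1 ^ 2 - 4 * u.1 * u.2.2 = D * q ^ 2) (hp : ¬ DvdF q u) :
    ∃ (γ : SL) (a b c : ℤ), qact u γ.1 = (a, b * q, c * q ^ 2) ∧ ¬ (q : ℤ) ∣ a := by
  have hqp : Prime (q : ℤ) := Nat.prime_iff_prime_int.mp hq
  have hq0 : (q : ℤ) ≠ 0 := hqp.ne_zero
  -- step 1
  obtain ⟨γ₁, h1⟩ : ∃ γ : SL, ¬ (q : ℤ) ∣ (qact u γ.1).1 := by
    by_cases ha : (q : ℤ) ∣ u.1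
    · by_cases hc : (q : ℤ) ∣ u.2.2
      · refine ⟨⟨!![1, 0; 1, 1], by simp [Matrix.det_fin_two_of]⟩, ?_⟩
        intro h
        simp [qact] at h
        refine hp ⟨ha, ?_, hc⟩
        have := dvd_sub (dvd_sub h ha) hc
        ring_nf at this
        exact this
      · refine ⟨⟨!![0, -1; 1, 0], by simp [Matrix.det_fin_two_of]⟩, ?_⟩
        simpa [qact] using hc
    · exact ⟨1, by rw [Matrix.SpecialLinearGroup.coe_one, qact_one]; exact ha⟩
  have hd1 := qact_disc u γ₁.1
  rw [γ₁.2, hu] at hd1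
  rcases hv : qact u γ₁.1 with ⟨a, b, c⟩
  simp only [hv] at h1 hd1
  -- step 2
  obtain ⟨j, b', hj, hc⟩ : ∃ j b' : ℤ, 2 * a * j + b = b' * q ∧ (b' ^ 2 - D) % 4 = 0 := by
    rcases hq.eq_two_or_odd' with h2 | hodd
    · subst h2
      have hbe : Even (b ^ 2) := ⟨2 * D + 2 * a * c, by push_cast at hd1; linear_combination hd1⟩
      rw [Int.even_pow' two_ne_zero] at hbe
      obtain ⟨b₀, hb₀⟩ := hbe
      have hao : a % 2 = 1 := by push_cast at h1; omega
      have hs : ∀ x : ℤ, x % 2 = D % 2 → (x ^ 2 - D) % 4 = 0 := by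
        intro x hx
        rcases Int.even_or_odd' x with ⟨k, hk | hk⟩
        · have : x ^ 2 = 4 * k ^ 2 := by rw [hk]; ring
          omega
        · have : x ^ 2 = 4 * (k ^ 2 + k) + 1 := by rw [hk]; ring
          omega
      by_cases hpar : b₀ % 2 = D % 2
      · exact ⟨0, b₀, by push_cast; linarith, hs _ hpar⟩
      · exact ⟨1, b₀ + a, by push_cast; linarith, hs _ (by omega)⟩
    · have hcop : IsCoprime (2 * a) (q : ℤ) := by
        rw [isCoprime_comm, hqp.coprime_iff_not_dvd]
        intro h
        rcases hqp.dvd_or_dvd h with h | h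
        · have : q ∣ 2 := by exact_mod_cast h
          have := (Nat.prime_dvd_prime_iff_eq hq Nat.prime_two).1 this
          subst this
          exact absurd hodd (by decide)
        · exact h1 h
      obtain ⟨r, s, hrs⟩ := hcop
      refine ⟨-b * r, s * b, by linear_combination -b * hrs, ?_⟩
      have hb2 : (s * b * q) ^ 2 - 4 * (a * (a * (-b * r) ^ 2 + b * (-b * r) + c)) = D * q ^ 2 := by
        linear_combination hd1 + b ^ 2 * (s * q + 1 - 2 * a * r) * hrs
      obtain ⟨m, hm'⟩ := hodd
      have hq2 : (q : ℤ) ^ 2 = 4 * (m ^ 2 + m) + 1 := by rw [hm']; push_cast; ring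
      generalize a * (a * (-b * r) ^ 2 + b * (-b * r) + c) = X at hb2
      have h5 : (s * b) ^ 2 - D = 4 * (X - ((s * b) ^ 2 - D) * (m ^ 2 + m)) := by
        have : (s * b * q) ^ 2 = (s * b) ^ 2 * q ^ 2 := by ring
        rw [this, hq2] at hb2
        linear_combination hb2
      omega
  set c₁ := a * j ^ 2 + b * j + c with hc₁
  have hd2 : (b' * q) ^ 2 - 4 * a * c₁ = D * q ^ 2 := by
    rw [← hj, hc₁]
    linear_combination hd1
  obtain ⟨e, he⟩ : (4 : ℤ) ∣ b' ^ 2 - D := Int.dvd_of_emod_eq_zero hc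
  have h6 : a * c₁ = q ^ 2 * e := by
    have : 4 * (a * c₁) = 4 * (q ^ 2 * e) := by
      linear_combination -hd2 + q ^ 2 * he
    exact mul_left_cancel₀ (by norm_num) this
  have h7 : (q : ℤ) ^ 2 ∣ c₁ := by
    have hcop : IsCoprime ((q : ℤ) ^ 2) a := by
      apply IsCoprime.pow_left
      rw [hqp.coprime_iff_not_dvd]; exact h1
    exact hcop.dvd_of_dvd_mul_left ⟨e, h6⟩
  obtain ⟨c', hc'⟩ := h7
  refine ⟨γ₁ * ⟨!![1, j; 0, 1], by simp [Matrix.det_fin_two_of]⟩, a, b', c', ?_, h1⟩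
  change qact u (γ₁.1 * !![1, j; 0, 1]) = _
  rw [← qact_mul, hv, ← hj]
  refine Prod.ext ?_ (Prod.ext ?_ ?_)
  · simp [qact]
  · simp [qact]
  · simp [qact]
    linear_combination hc'

theorem overlattice (q : ℕ) (hq : q.Prime) (D : ℤ) (hm : D % 4 = 0 ∨ D % 4 = 1)
    (u : ℤ × ℤ × ℤ) (hu : IsPrimPosDefBQF (D * q ^ 2) u) (hD : D < 0) :
    ∃ (t : ℤ × ℤ × ℤ) (M₀ : Matrix (Fin 2) (Fin 2) ℤ), IsPrimPosDefBQF D t ∧ M₀.det = q ∧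
      qact t M₀ = u ∧ ∀ (t' : ℤ × ℤ × ℤ) (M : Matrix (Fin 2) (Fin 2) ℤ), M.det = q →
        qact t' M = u → ∃ σ : SL, M = σ.1 * M₀ := by
  have hqp : Prime (q : ℤ) := Nat.prime_iff_prime_int.mp hq
  have hq0 : (q : ℤ) ≠ 0 := hqp.ne_zero
  have hDq : D * q ^ 2 < 0 := mul_neg_of_neg_of_pos hD (by positivity)
  obtain ⟨γ, a, b, c, hn, ha⟩ := normal_form q hq D hm u hu.1 ((prim_iff u).1 hu.2.1 q hq)
  have hpn := prim_act hDq hu γ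
  have hinv := qact_inv _ _ _ hn
  rw [hn] at hpn
  have hdi : qact (a, b, c) !![1, 0; 0, (q : ℤ)] = (a, b * q, c * q ^ 2) := by
    simp [qact]
  refine ⟨(a, b, c), !![1, 0; 0, (q : ℤ)] * (γ⁻¹).1, ⟨?_, ?_, hpn.2.2⟩, ?_, ?_, ?_⟩
  · have := hpn.1
    simp only at this ⊢
    apply mul_right_cancel₀ (pow_ne_zero 2 hq0)
    rw [← this]; ring
  · rw [prim_iff]
    intro p hp h
    have := h.act !![1, 0; 0, (q : ℤ)]
    rw [hdi] at this
    exact (prim_iff _).1 hpn.2.1 p hp this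
  · rw [Matrix.det_mul, (γ⁻¹).2]; simp [Matrix.det_fin_two_of]
  · rw [← qact_mul, hdi, hinv]
  · intro t' M hM ht
    -- pass to M * γ
    have ht2 : qact t' (M * γ.1) = (a, b * q, c * q ^ 2) := by rw [← qact_mul, ht, hn]
    have hd : (M * γ.1).det = q := by rw [Matrix.det_mul, hM, γ.2, mul_one]
    have hMg : M = (M * γ.1) * (γ⁻¹).1 := by
      rw [mul_assoc, ← Matrix.SpecialLinearGroup.coe_mul, mul_inv_cancel,
        Matrix.SpecialLinearGroup.coe_one, mul_one]
    generalize M * γ.1 = X at ht2 hd hMg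
    rw [Matrix.det_fin_two] at hd
    simp only [qact, Prod.mk.injEq] at ht2
    obtain ⟨e1, e2, e3⟩ := ht2
    have key : ∀ x : ℤ, (q : ℤ) ∣ x ^ 2 * a → (q : ℤ) ∣ x := fun x hx =>
      hqp.dvd_of_dvd_pow ((hqp.dvd_or_dvd hx).resolve_right ha)
    have k1 : (q : ℤ) ∣ X 1 1 := by
      apply key
      refine ⟨X 1 0 ^ 2 * c * q + t'.1 * (X 0 0 * X 1 1 + X 0 1 * X 1 0) + t'.2.1 * X 1 0 * X 1 1, ?_⟩
      linear_combination -X 1 1 ^ 2 * e1 + X 1 0 ^ 2 * e3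
        + (t'.1 * (X 0 0 * X 1 1 + X 0 1 * X 1 0) + t'.2.1 * X 1 0 * X 1 1) * hd
    have k2 : (q : ℤ) ∣ X 0 1 := by
      apply key
      refine ⟨X 0 0 ^ 2 * c * q - t'.2.1 * X 0 0 * X 0 1
        - t'.2.2 * (X 0 0 * X 1 1 + X 0 1 * X 1 0), ?_⟩
      linear_combination -X 0 1 ^ 2 * e1 + X 0 0 ^ 2 * e3
        - (t'.2.1 * X 0 0 * X 0 1 + t'.2.2 * (X 0 0 * X 1 1 + X 0 1 * X 1 0)) * hd
    obtain ⟨w, hw⟩ := k1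
    obtain ⟨y, hy⟩ := k2
    refine ⟨⟨!![X 0 0, y; X 1 0, w], ?_⟩, ?_⟩
    · rw [Matrix.det_fin_two_of]
      apply mul_left_cancel₀ hq0
      rw [hw, hy] at hd
      linear_combination hd
    · rw [hMg, ← mul_assoc]
      congr 1
      ext i j
      fin_cases i <;> fin_cases j <;> simp [Matrix.mul_apply, Fin.sum_univ_two, hw, hy, mul_comm]

end HRed
namespace HRed

def Good (q : ℕ) (f : ℤ × ℤ × ℤ) (i : Option (ZMod q)) : Prop := ¬ DvdF q (qact f (Mi q i))

theorem good_prim {q : ℕ} (hq : q.Prime) {D : ℤ} (hD : D < 0) {f : ℤ × ℤ × ℤ}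
    (hf : IsPrimPosDefBQF D f) {i : Option (ZMod q)} (hi : Good q f i) :
    IsPrimPosDefBQF (D * q ^ 2) (qact f (Mi q i)) := by
  refine ⟨?_, ?_, qact_pos hD hf ?_⟩
  · rw [qact_disc, Mi_det, hf.1]; ring
  · rw [prim_iff]
    intro p hp h
    by_cases hpq : p = q
    · subst hpq; exact hi h
    · refine (prim_iff f).1 hf.2.1 p hp (DvdF.of_act hp ?_ h)
      rw [Mi_det]
      intro h'
      exact hpq ((Nat.prime_dvd_prime_iff_eq hp hq).1 (by exact_mod_cast h'))
  · rw [Mi_det]; exact_mod_cast hq.ne_zero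

theorem class_relation (q : ℕ) (hq : q.Prime) (D : ℤ) (hD : D < 0)
    (hm : D % 4 = 0 ∨ D % 4 = 1) (n : ℕ) (hn : 0 < n)
    (hcount : ∀ f, IsPrimPosDefBQF D f → Nat.card {i : Option (ZMod q) // Good q f i} = n) :
    classNum D * n * wAut (D * q ^ 2) = classNum (D * q ^ 2) * wAut D := by
  have hq0 : (q : ℤ) ≠ 0 := by exact_mod_cast hq.ne_zero
  have hDq : D * q ^ 2 < 0 := mul_neg_of_neg_of_pos hD (by positivity)
  have wpos : ∀ D, 0 < wAut D := by intro D; unfold wAut; split_ifs <;> norm_num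
  let P := {x : Cl D × Option (ZMod q) // Good q (rep x.1) x.2}
  let A := {x : Cl D × Option (ZMod q) × SL × Cl (D * q ^ 2) //
    qact (rep x.1) (Mi q x.2.1 * x.2.2.1.1) = rep x.2.2.2}
  have cP : Nat.card P = classNum D * n := by
    refine fiber_card (fun x : P => x.1.1) n hn fun t => ?_
    rw [← hcount (rep t) (rep_prim t)]
    symm
    refine Nat.card_congr (Equiv.ofBijective
      (fun i => ⟨⟨(t, i.1), i.2⟩, rfl⟩) ⟨?_, ?_⟩)
    · intro i i' h
      exact Subtype.ext (congrArg (fun z => z.1.1.2) h)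
    · rintro ⟨⟨⟨t', i⟩, hi⟩, rfl⟩
      exact ⟨⟨i, hi⟩, rfl⟩
  have hAgood : ∀ x : A, Good q (rep x.1.1) x.1.2.1 := by
    rintro ⟨⟨t, i, γ, u⟩, hx⟩ h
    simp only at hx h
    have h2 := DvdF.act h γ.1
    rw [qact_mul, hx] at h2
    exact (prim_iff _).1 (rep_prim u).2.1 q hq h2
  have cA : Nat.card A = Nat.card P * wAut (D * q ^ 2) := by
    refine fiber_card (fun x : A => (⟨(x.1.1, x.1.2.1), hAgood x⟩ : P)) _ (wpos _) ?_
    rintro ⟨⟨t, i⟩, hti⟩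
    have hpr := good_prim hq hD (rep_prim t) hti
    obtain ⟨u₀, M₀, hM₀⟩ := exists_rep _ hpr
    rw [← transporter_card hDq hpr M₀ hM₀]
    symm
    refine Nat.card_congr (Equiv.ofBijective
      (fun γ => ⟨⟨(t, i, γ.1, u₀), ?_⟩, rfl⟩) ⟨?_, ?_⟩)
    · have := γ.2
      rw [qact_mul] at this
      exact this
    · intro γ γ' h
      exact Subtype.ext (congrArg (fun z => z.1.1.2.2.1) h)
    · rintro ⟨⟨⟨t', i', γ, u⟩, hx⟩, hb⟩
      simp only [Subtype.mk.injEq, Prod.mk.injEq] at hb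
      obtain ⟨rfl, rfl⟩ := hb
      simp only at hx hM₀
      have hu : u = u₀ := by
        apply rep_unique u u₀ (γ⁻¹ * M₀)
        rw [← hx, ← qact_mul, Matrix.SpecialLinearGroup.coe_mul, ← qact_mul,
          qact_inv _ _ γ rfl, hM₀]
      subst hu
      exact ⟨⟨γ, by rw [qact_mul]; exact hx⟩, rfl⟩
  have cA' : Nat.card A = classNum (D * q ^ 2) * wAut D := by
    refine fiber_card (fun x : A => x.1.2.2.2) _ (wpos _) ?_
    intro u
    obtain ⟨t, M, ht, hMdet, htM, huniq⟩ := overlattice q hq D hm (rep u) (rep_prim u) hD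
    obtain ⟨t₀, γ₀, hγ₀⟩ := exists_rep t ht
    -- M₀ = γ₀⁻¹ M
    set M₀ : Matrix (Fin 2) (Fin 2) ℤ := (γ₀⁻¹).1 * M with hM₀
    have hM₀det : M₀.det = q := by rw [hM₀, Matrix.det_mul, (γ₀⁻¹).2, hMdet, one_mul]
    have hM₀ne : M₀.det ≠ 0 := by rw [hM₀det]; exact hq0
    have ht₀ : qact (rep t₀) M₀ = rep u := by
      rw [hM₀, ← qact_mul, qact_inv _ _ _ hγ₀, htM]
    have huniq' : ∀ (t' : ℤ × ℤ × ℤ) (X : Matrix (Fin 2) (Fin 2) ℤ), X.det = q →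
        qact t' X = rep u → ∃ σ : SL, X = σ.1 * M₀ := by
      intro t' X hX h
      obtain ⟨σ, hσ⟩ := huniq t' X hX h
      refine ⟨σ * γ₀, ?_⟩
      rw [hσ, hM₀, ← mul_assoc, ← Matrix.SpecialLinearGroup.coe_mul, mul_assoc, mul_inv_cancel,
        mul_one]
    have hdec : ∀ σ : SL, ∃ (i : Option (ZMod q)) (γ : SL), σ.1 * M₀ = Mi q i * γ.1 := by
      intro σ
      apply hnf_exists q hq
      rw [Matrix.det_mul, σ.2, one_mul, hM₀det]
    choose di dγ hd using hdec
    rw [← transporter_card hD (rep_prim t₀) 1 (qact_one _)]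
    symm
    refine Nat.card_congr (Equiv.ofBijective
      (fun σ => ⟨⟨(t₀, di σ.1, dγ σ.1, u), ?_⟩, rfl⟩) ⟨?_, ?_⟩)
    · change qact (rep t₀) (Mi q (di σ.1) * (dγ σ.1).1) = rep u
      rw [← hd, ← qact_mul, σ.2, ht₀]
    · intro σ σ' h
      have e1 : di σ.1 = di σ'.1 := congrArg (fun z => z.1.1.2.1) h
      have e2 : dγ σ.1 = dγ σ'.1 := congrArg (fun z => z.1.1.2.2.1) h
      apply Subtype.ext
      apply Subtype.ext
      apply mul_right_cancel_det hM₀ne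
      rw [hd, hd, e1, e2]
    · rintro ⟨⟨⟨t', i, γ, u'⟩, hx⟩, hb⟩
      simp only at hb
      subst hb
      simp only at hx
      obtain ⟨σ, hσ⟩ := huniq' _ _ (by rw [Matrix.det_mul, Mi_det, γ.2, mul_one]) hx
      have h1 : qact (rep t') σ.1 = rep t₀ := by
        apply qact_cancel hM₀ne
        rw [qact_mul, ← hσ, hx, ht₀]
      have h2 := rep_unique _ _ _ h1
      subst h2
      have h3 := hnf_unique q hq _ _ _ _ ((hd σ).symm.trans hσ.symm)
      refine ⟨⟨σ, h1⟩, ?_⟩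
      simp only [h3.1, h3.2]
  rw [← cA', cA, cP]

/-! ### Counting points on the projective line -/

theorem good_none (q : ℕ) (f : ℤ × ℤ × ℤ) : Good q f none ↔ (f.1 : ZMod q) ≠ 0 := by
  rw [Good, Ne, ZMod.intCast_zmod_eq_zero_iff_dvd, not_iff_not]
  constructor
  · intro h
    have := h.1
    simpa [qact, Mi] using this
  · intro h
    refine ⟨?_, ?_, ?_⟩ <;> simp [qact, Mi]
    · exact h
    · exact ⟨f.2.2 * q, by ring⟩

theorem good_some (q : ℕ) [NeZero q] (f : ℤ × ℤ × ℤ) (j : ZMod q) : Good q f (some j) ↔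
    (f.1 : ZMod q) * j ^ 2 + f.2.1 * j + f.2.2 ≠ 0 := by
  have : (f.1 : ZMod q) * j ^ 2 + f.2.1 * j + f.2.2
      = ((f.1 * (j.val : ℤ) ^ 2 + f.2.1 * (j.val : ℤ) + f.2.2 : ℤ) : ZMod q) := by
    push_cast; simp
  rw [Good, Ne, this, ZMod.intCast_zmod_eq_zero_iff_dvd, not_iff_not]
  constructor
  · intro h
    have := h.2.2
    simpa [qact, Mi] using this
  · intro h
    refine ⟨?_, ?_, ?_⟩ <;> simp [qact, Mi]
    · exact Dvd.intro_left (f.1 * q) (by ring)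
    · exact ⟨2 * f.1 * j.cast, by ring⟩
    · simpa using h

theorem card_option_sub (q : ℕ) [NeZero q] (p : Option (ZMod q) → Prop) :
    Nat.card {i // p i} = (if p none then 1 else 0) +
      (Finset.univ.filter fun j : ZMod q => p (some j)).card := by
  rw [Nat.card_eq_fintype_card, Fintype.card_subtype, Finset.card_filter, Fintype.sum_option,
    Finset.card_filter]

theorem kron_odd (q : ℕ) (hq : q.Prime) (h2 : q ≠ 2) (D : ℤ) [Fact q.Prime] :
    kroneckerSym D q = legendreSym q D := by
  have : padicValNat 2 q = 0 := by
    apply padicValNat.eq_zero_of_not_dvd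
    intro h
    exact h2 ((Nat.prime_dvd_prime_iff_eq Nat.prime_two hq).1 h).symm
  rw [kroneckerSym, this]
  simp [jacobiSym.legendreSym.to_jacobiSym]

theorem kron_two (D : ℤ) : kroneckerSym D 2 = kron2 D := by
  simp [kroneckerSym]

end HRed
namespace HRed

theorem good_count_odd (q : ℕ) (hq : q.Prime) (h2 : q ≠ 2) (D : ℤ) (f : ℤ × ℤ × ℤ)
    (hf : IsPrimPosDefBQF D f) :
    (Nat.card {i : Option (ZMod q) // Good q f i} : ℤ) = q - kroneckerSym D q := by
  have : Fact q.Prime := ⟨hq⟩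
  rw [kron_odd q hq h2 D, card_option_sub]
  simp only [good_none, good_some]
  have hs := legendreSym.card_sqrts q h2 D
  have hdisc : (D : ZMod q) = (f.2.1 : ZMod q) ^ 2 - 4 * f.1 * f.2.2 := by
    rw [← hf.1]; push_cast; ring
  have hprim := (prim_iff f).1 hf.2.1 q hq
  have htwo : (2 : ZMod q) ≠ 0 := by
    intro h
    have : ((2 : ℕ) : ZMod q) = 0 := by exact_mod_cast h
    rw [ZMod.natCast_eq_zero_iff] at this
    exact h2 ((Nat.prime_dvd_prime_iff_eq hq Nat.prime_two).1 this)
  have hnz : ¬ ((f.1 : ZMod q) = 0 ∧ (f.2.1 : ZMod q) = 0 ∧ (f.2.2 : ZMod q) = 0) := by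
    rintro ⟨h1, h2, h3⟩
    rw [ZMod.intCast_zmod_eq_zero_iff_dvd] at h1 h2 h3
    exact hprim ⟨h1, h2, h3⟩
  have hleg : legendreSym q D = (Finset.univ.filter fun y : ZMod q => y ^ 2 = D).card - 1 := by
    have : {x : ZMod q | x ^ 2 = D}.toFinset = Finset.univ.filter fun y : ZMod q => y ^ 2 = D := by
      ext x; simp
    rw [this] at hs
    linarith
  rw [hleg]
  generalize (f.1 : ZMod q) = a at *
  generalize (f.2.1 : ZMod q) = b at *
  generalize (f.2.2 : ZMod q) = c at *
  generalize (D : ZMod q) = E at *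
  have hsum : (Finset.univ.filter fun j : ZMod q => a * j ^ 2 + b * j + c = 0).card
      + (Finset.univ.filter fun j : ZMod q => a * j ^ 2 + b * j + c ≠ 0).card = q := by
    rw [Finset.card_filter_add_card_filter_not, Finset.card_univ, ZMod.card]
  by_cases ha : a = 0
  · subst ha
    by_cases hb : b = 0
    · subst hb
      have hc : c ≠ 0 := fun h => hnz ⟨rfl, rfl, h⟩
      have e1 : (Finset.univ.filter fun j : ZMod q => (0 : ZMod q) * j ^ 2 + 0 * j + c = 0) = ∅ := by
        ext j; simp [hc]
      have e2 : (Finset.univ.filter fun y : ZMod q => y ^ 2 = E) = {0} := by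
        ext y; simp [hdisc]
      rw [e1] at hsum
      rw [e2]
      simp only [Finset.card_empty, Finset.card_singleton, ne_eq] at hsum ⊢
      simp only [ not_true_eq_false, if_false]
      push_cast
      omega
    · have e1 : (Finset.univ.filter fun j : ZMod q => (0 : ZMod q) * j ^ 2 + b * j + c = 0)
          = {-c / b} := by
        ext j
        simp only [Finset.mem_filter, Finset.mem_univ, true_and, Finset.mem_singleton]
        rw [eq_div_iff hb]
        constructor <;> intro h <;> linear_combination h
      have e2 : (Finset.univ.filter fun y : ZMod q => y ^ 2 = E) = {b, -b} := by
        ext y; simp [hdisc, sq_eq_sq_iff_eq_or_eq_neg]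
      have hne : b ≠ -b := by
        intro h
        have : 2 * b = 0 := by linear_combination h
        rcases mul_eq_zero.1 this with h | h
        · exact htwo h
        · exact hb h
      rw [e1] at hsum
      rw [e2, Finset.card_pair hne]
      simp only [Finset.card_singleton, ne_eq] at hsum ⊢
      simp only [ not_true_eq_false, if_false]
      push_cast
      omega
  · have h2a : 2 * a ≠ 0 := mul_ne_zero htwo ha
    have e1 : (Finset.univ.filter fun y : ZMod q => y ^ 2 = E).card =
        (Finset.univ.filter fun j : ZMod q => a * j ^ 2 + b * j + c = 0).card := by
      symm
      refine Finset.card_bij (fun j _ => 2 * a * j + b) ?_ ?_ ?_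
      · intro j hj
        simp only [Finset.mem_filter, Finset.mem_univ, true_and] at hj ⊢
        rw [hdisc]
        linear_combination 4 * a * hj
      · intro j _ j' _ h
        exact mul_left_cancel₀ h2a (add_right_cancel h)
      · intro y hy
        simp only [Finset.mem_filter, Finset.mem_univ, true_and] at hy ⊢
        refine ⟨(y - b) / (2 * a), ?_, by field_simp; ring⟩
        have h4a : 4 * a ≠ 0 := by
          have : (4 : ZMod q) * a = 2 * (2 * a) := by ring
          rw [this]; exact mul_ne_zero htwo h2a
        apply mul_left_cancel₀ h4a
        have hj : 2 * a * ((y - b) / (2 * a)) = y - b := by field_simp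
        generalize (y - b) / (2 * a) = j at hj
        have hy' : y = 2 * a * j + b := by linear_combination -hj
        rw [hdisc, hy'] at hy
        linear_combination hy
    rw [e1]
    simp only [ne_eq, ha, not_false_eq_true, if_true]
    push_cast
    simp only [ne_eq] at hsum
    omega

theorem good_count_two (D : ℤ) (f : ℤ × ℤ × ℤ) (hf : IsPrimPosDefBQF D f) :
    (Nat.card {i : Option (ZMod 2) // Good 2 f i} : ℤ) = 2 - kroneckerSym D 2 := by
  rw [kron_two, card_option_sub, Finset.card_filter]
  have hu : (Finset.univ : Finset (ZMod 2)) = {0, 1} := by decide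
  rw [hu, Finset.sum_pair (by decide)]
  simp only [good_none, good_some]
  have hz : ∀ x : ℤ, ((x : ZMod 2) ≠ 0) ↔ x % 2 = 1 := by
    intro x
    rw [Ne, ZMod.intCast_zmod_eq_zero_iff_dvd]
    push_cast
    omega
  have e0 : ((f.1 : ZMod 2) * 0 ^ 2 + f.2.1 * 0 + f.2.2 ≠ 0) ↔ f.2.2 % 2 = 1 := by
    rw [← hz]; simp
  have e1 : ((f.1 : ZMod 2) * 1 ^ 2 + f.2.1 * 1 + f.2.2 ≠ 0) ↔ (f.1 + f.2.1 + f.2.2) % 2 = 1 := by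
    rw [← hz]; push_cast; simp
  simp only [e0, e1, hz]
  have hprim := (prim_iff f).1 hf.2.1 2 Nat.prime_two
  have hd := hf.1
  have hnz : ¬ (f.1 % 2 = 0 ∧ f.2.1 % 2 = 0 ∧ f.2.2 % 2 = 0) := by
    rintro ⟨h1, h2, h3⟩
    exact hprim ⟨Int.dvd_of_emod_eq_zero h1, Int.dvd_of_emod_eq_zero h2,
      Int.dvd_of_emod_eq_zero h3⟩
  generalize f.1 = a at *
  generalize f.2.1 = b at *
  generalize f.2.2 = c at *
  unfold kron2
  rcases Int.even_or_odd' b with ⟨k, hk | hk⟩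
  · have h1 : D % 2 = 0 := by
      have : D = 2 * (2 * k ^ 2 - 2 * a * c) := by rw [← hd, hk]; ring
      omega
    simp only [h1, if_true]
    split_ifs <;> first | rfl | omega
  · obtain ⟨m, hm⟩ : ∃ m, k * (k + 1) = m + m := Int.even_mul_succ_self k
    have hD : D = 8 * m + 1 - 4 * (a * c) := by rw [← hd, hk]; linear_combination 4 * hm
    by_cases hac : a % 2 = 1 ∧ c % 2 = 1
    · have : (a * c) % 2 = 1 := by rw [Int.mul_emod, hac.1, hac.2]; rfl
      rw [if_neg (by omega : ¬ D % 2 = 0), if_neg (by omega : ¬ (D % 8 = 1 ∨ D % 8 = 7))]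
      split_ifs <;> first | rfl | omega
    · have : (a * c) % 2 = 0 := by
        rcases (by omega : a % 2 = 0 ∨ c % 2 = 0) with h | h <;> rw [Int.mul_emod, h] <;> simp
      rw [if_neg (by omega : ¬ D % 2 = 0), if_pos (by omega : (D % 8 = 1 ∨ D % 8 = 7))]
      split_ifs <;> first | rfl | omega

theorem kron_le (q : ℕ) (D : ℤ) (hq : q.Prime) : kroneckerSym D q ≤ 1 := by
  by_cases h2 : q = 2
  · subst h2
    rw [kron_two]; unfold kron2; split_ifs <;> norm_num
  · have : Fact q.Prime := ⟨hq⟩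
    rw [kron_odd q hq h2]
    by_cases h : (D : ZMod q) = 0
    · rw [(legendreSym.eq_zero_iff q D).2 h]; norm_num
    · rcases legendreSym.eq_one_or_neg_one q h with h | h <;> rw [h]; norm_num

theorem kron_dvd (q : ℕ) (D : ℤ) (hq : q.Prime) (h : (q : ℤ) ∣ D) : kroneckerSym D q = 0 := by
  by_cases h2 : q = 2
  · subst h2
    rw [kron_two]; unfold kron2; rw [if_pos]; push_cast at h; omega
  · have : Fact q.Prime := ⟨hq⟩
    rw [kron_odd q hq h2, legendreSym.eq_zero_iff, ZMod.intCast_zmod_eq_zero_iff_dvd]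
    exact h

theorem kron_sq (q : ℕ) (d : ℤ) (g : ℕ) (hq : q.Prime) (h : ¬ q ∣ g) :
    kroneckerSym (d * (g : ℤ) ^ 2) q = kroneckerSym d q := by
  by_cases h2 : q = 2
  · subst h2
    rw [kron_two, kron_two]
    obtain ⟨k, hk⟩ : ∃ k, g = 2 * k + 1 := ⟨g / 2, by omega⟩
    obtain ⟨m, hm⟩ : ∃ m, (k : ℤ) * (k + 1) = m + m := Int.even_mul_succ_self (k : ℤ)
    have : d * (g : ℤ) ^ 2 = d + 8 * (d * m) := by
      rw [hk]; push_cast; linear_combination 4 * d * hm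
    rw [this]
    unfold kron2
    have e1 : (d + 8 * (d * m)) % 2 = d % 2 := by omega
    have e2 : (d + 8 * (d * m)) % 8 = d % 8 := by omega
    rw [e1, e2]
  · have : Fact q.Prime := ⟨hq⟩
    rw [kron_odd q hq h2, kron_odd q hq h2, legendreSym.mul, legendreSym.sq_one', mul_one]
    simpa [ZMod.natCast_eq_zero_iff] using h

noncomputable def ms (D : ℤ) : ℚ := (classNum D : ℚ) / ((wAut D : ℚ) / 2)

theorem ms_step (q : ℕ) (hq : q.Prime) (D : ℤ) (hD : D < 0) (hm : D % 4 = 0 ∨ D % 4 = 1) :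
    ms (D * q ^ 2) = (q - kroneckerSym D q) * ms D := by
  have hk := kron_le q D hq
  have hq2 := hq.two_le
  obtain ⟨n, hn⟩ : ∃ n : ℕ, (n : ℤ) = q - kroneckerSym D q :=
    ⟨((q : ℤ) - kroneckerSym D q).toNat, by omega⟩
  have hpos : 0 < n := by omega
  have hc := class_relation q hq D hD hm n hpos fun f hf => by
    have : (Nat.card {i : Option (ZMod q) // Good q f i} : ℤ) = n := by
      rw [hn]
      by_cases h2 : q = 2
      · subst h2; exact good_count_two D f hf
      · exact good_count_odd q hq h2 D f hf
    exact_mod_cast this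
  have wpos : ∀ D, (0 : ℚ) < wAut D := by
    intro D; unfold wAut; split_ifs <;> norm_num
  have h1 := wpos D
  have h2 := wpos (D * q ^ 2)
  have hn' : (q : ℚ) - kroneckerSym D q = n := by exact_mod_cast hn.symm
  rw [hn', ms, ms]
  have hc' : (classNum D : ℚ) * n * wAut (D * q ^ 2) = classNum (D * q ^ 2) * wAut D := by
    exact_mod_cast hc
  field_simp
  linear_combination -hc'

theorem ms_zero (D : ℤ) (hm : ¬ (D % 4 = 0 ∨ D % 4 = 1)) : ms D = 0 := by
  have : classNum D = 0 := by
    unfold classNum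
    have : IsEmpty {f : ℤ × ℤ × ℤ // IsPrimPosDefBQF D f} := ⟨fun f => hm (disc_mod f.2)⟩
    have : IsEmpty (Quot fun f g : {f : ℤ × ℤ × ℤ // IsPrimPosDefBQF D f} => BQFEquiv f.1 g.1) :=
      ⟨fun t => this.false t.out⟩
    exact Nat.card_of_isEmpty
  simp [ms, this]

theorem mod4_sq (d g : ℤ) (h : d % 4 = 0 ∨ d % 4 = 1) :
    (d * g ^ 2) % 4 = 0 ∨ (d * g ^ 2) % 4 = 1 := by
  rcases Int.even_or_odd' g with ⟨k, hk | hk⟩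
  · have : d * g ^ 2 = 4 * (d * k ^ 2) := by rw [hk]; ring
    omega
  · have : d * g ^ 2 = d + 4 * (d * (k ^ 2 + k)) := by rw [hk]; ring
    omega

theorem ms_pow (q : ℕ) (hq : q.Prime) (D : ℤ) (hD : D < 0) (hm : D % 4 = 0 ∨ D % 4 = 1) (j : ℕ) :
    ms (D * ((q ^ (j + 1) : ℕ) : ℤ) ^ 2) = q ^ j * (q - kroneckerSym D q) * ms D := by
  induction j with
  | zero => simpa using ms_step q hq D hD hm
  | succ j ih =>
    have hq0 : (q : ℤ) ≠ 0 := by exact_mod_cast hq.ne_zero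
    have hpos : (0 : ℤ) < ((q ^ (j + 1) : ℕ) : ℤ) ^ 2 := by
      have := hq.pos
      positivity
    have e : D * ((q ^ (j + 1 + 1) : ℕ) : ℤ) ^ 2 = D * ((q ^ (j + 1) : ℕ) : ℤ) ^ 2 * q ^ 2 := by
      push_cast; ring
    rw [e, ms_step q hq _ (mul_neg_of_neg_of_pos hD hpos) (mod4_sq _ _ hm), ih,
      kron_dvd q _ hq]
    · push_cast; ring
    · push_cast
      exact Dvd.intro_left (D * (q ^ j) ^ 2 * q) (by ring)

end HRed
namespace HRed

theorem fund_mod {d : ℤ} (h : IsFundamentalDisc d) : d % 4 = 0 ∨ d % 4 = 1 := by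
  rcases h with h | h
  · exact Or.inr h.1
  · exact Or.inl h.1

theorem fund_dvd {d : ℤ} (hfund : IsFundamentalDisc d) (F f : ℕ) (hf : 0 < f) (D' : ℤ)
    (h : d * (F : ℤ) ^ 2 = D' * (f : ℤ) ^ 2) (hm : D' % 4 = 0 ∨ D' % 4 = 1) : f ∣ F := by
  obtain ⟨g, f₁, F₁, hg, hcop, rfl, rfl⟩ := Nat.exists_coprime' (m := f) (n := F)
    (Nat.gcd_pos_of_pos_left _ hf)
  have hg0 : ((g : ℤ)) ^ 2 ≠ 0 := by positivity
  have h1 : d * (F₁ : ℤ) ^ 2 = D' * (f₁ : ℤ) ^ 2 := by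
    apply mul_right_cancel₀ hg0
    push_cast at h
    linear_combination h
  have hcopz : IsCoprime ((f₁ : ℤ)) (F₁ : ℤ) := Nat.isCoprime_iff_coprime.2 hcop
  have hdvd : (f₁ : ℤ) ^ 2 ∣ d := (hcopz.pow (m := 2) (n := 2)).dvd_of_dvd_mul_right
    (Dvd.intro_left D' h1.symm)
  suffices hone : f₁ = 1 by
    rw [hone, one_mul]; exact Dvd.intro_left _ rfl
  have unit_one : ∀ x : ℕ, IsUnit (x : ℤ) → x = 1 := by
    intro x hx
    have := Int.isUnit_iff.1 hx
    omega
  rcases hfund with ⟨-, hsq⟩ | ⟨h4, hsq, hmod⟩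
  · apply unit_one
    apply hsq
    rw [← pow_two]; exact hdvd
  · obtain ⟨m, rfl⟩ : ∃ m, d = 4 * m := ⟨d / 4, by omega⟩
    have e : 4 * m / 4 = m := by omega
    rw [e] at hsq hmod
    rcases Nat.even_or_odd' f₁ with ⟨f₂, hf₂ | hf₂⟩
    · have hf2 : (f₂ : ℤ) ^ 2 ∣ m := by
        rw [hf₂] at hdvd
        push_cast at hdvd
        have : (2 * (f₂ : ℤ)) ^ 2 = 4 * (f₂ : ℤ) ^ 2 := by ring
        rw [this] at hdvd
        exact Int.dvd_of_mul_dvd_mul_left (by norm_num) hdvd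
      have h2 : f₂ = 1 := by
        apply unit_one
        apply hsq
        rw [← pow_two]; exact hf2
      subst h2
      have hF : F₁ % 2 = 1 := by
        by_contra hF
        have h2F : 2 ∣ F₁ := by omega
        have := Nat.dvd_gcd (Dvd.intro 1 hf₂.symm) h2F
        rw [hcop] at this
        omega
      obtain ⟨s, hs⟩ : ∃ s : ℤ, (F₁ : ℤ) ^ 2 = 4 * s + 1 := by
        refine ⟨((F₁ / 2 : ℕ) : ℤ) ^ 2 + (F₁ / 2 : ℕ), ?_⟩
        have : (F₁ : ℤ) = 2 * (F₁ / 2 : ℕ) + 1 := by omega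
        rw [this]
        generalize ((F₁ / 2 : ℕ) : ℤ) = y
        have : (2 * y + 1) / 2 = y := by omega
        ring
      rw [hs, hf₂] at h1
      push_cast at h1
      have : D' = m + 4 * (m * s) := by linarith
      omega
    · apply unit_one
      apply hsq
      rw [← pow_two]
      refine IsCoprime.dvd_of_dvd_mul_left ?_ hdvd
      have : IsCoprime (f₁ : ℤ) 2 := by
        refine ⟨1, -f₂, ?_⟩
        rw [hf₂]; push_cast; ring
      have := this.pow (m := 2) (n := 2)
      norm_num at this
      exact this

theorem hurwitz_sum {d : ℤ} (hfund : IsFundamentalDisc d) (N F : ℕ) (hN : 0 < N)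
    (hdF : -(N : ℤ) = d * (F : ℤ) ^ 2) :
    hurwitz (N : ℚ) = ∑ g ∈ F.divisors, ms (d * (g : ℤ) ^ 2) := by
  have hF : F ≠ 0 := by
    rintro rfl
    simp at hdF; omega
  have hmod : N % 4 = 0 ∨ N % 4 = 3 := by
    have := mod4_sq d F (fund_mod hfund)
    rw [← hdF] at this
    omega
  have h1 : hurwitz (N : ℚ) = ∑ f ∈ N.divisors.filter fun f => f ^ 2 ∣ N,
      ms (-((N / f ^ 2 : ℕ) : ℤ)) := by
    have e0 : hurwitz (N : ℚ) = hurwitzNat N := by simp [hurwitz]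
    rw [e0]
    unfold hurwitzNat
    rw [if_pos ⟨hN, hmod⟩]
    rfl
  have hFN : ∀ f ∈ F.divisors, f ^ 2 ∣ N := by
    intro f hf
    have hf : f ∣ F := Nat.dvd_of_mem_divisors hf
    have h2 : ((f ^ 2 : ℕ) : ℤ) ∣ (N : ℤ) := by
      rw [← dvd_neg, hdF]
      push_cast
      exact Dvd.dvd.mul_left (pow_dvd_pow_of_dvd (by exact_mod_cast hf) 2) d
    exact_mod_cast h2
  rw [h1, ← Finset.sum_subset (s₁ := F.divisors)]
  · rw [← Nat.sum_div_divisors F (fun g => ms (d * (g : ℤ) ^ 2))]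
    refine Finset.sum_congr rfl fun f hf => ?_
    congr 1
    obtain ⟨g, hg⟩ := Nat.dvd_of_mem_divisors hf
    obtain ⟨n, hn⟩ := hFN f hf
    have hf0 : 0 < f := Nat.pos_of_mem_divisors hf
    rw [hn, Nat.mul_div_cancel_left _ (by positivity), hg, Nat.mul_div_cancel_left _ hf0]
    have hf2 : (f : ℤ) ^ 2 ≠ 0 := by positivity
    apply mul_left_cancel₀ hf2
    rw [hn, hg] at hdF
    push_cast at hdF
    linear_combination hdF
  · intro f hf
    have h2 := hFN f hf
    simp only [Finset.mem_filter, Nat.mem_divisors]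
    exact ⟨⟨(Dvd.intro_left (f ^ 1) (by ring)).trans h2, hN.ne'⟩, h2⟩
  · intro f hf hnf
    simp only [Finset.mem_filter, Nat.mem_divisors] at hf hnf
    apply ms_zero
    intro hm
    apply hnf
    refine ⟨?_, hF⟩
    refine fund_dvd hfund F f (Nat.pos_of_dvd_of_pos hf.1.1 hN) _ ?_ hm
    rw [← hdF]
    obtain ⟨n, hn⟩ := hf.2
    have hf0 : 0 < f := Nat.pos_of_dvd_of_pos hf.1.1 hN
    rw [hn, Nat.mul_div_cancel_left _ (by positivity)]
    push_cast; ring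

theorem sum_divisors_coprime {m n : ℕ} (hmn : m.Coprime n) (φ : ℕ → ℚ) :
    ∑ x ∈ (m * n).divisors, φ x = ∑ a ∈ m.divisors, ∑ b ∈ n.divisors, φ (a * b) := by
  rw [hmn.divisors_mul, Finset.sum_map]
  exact (Finset.sum_attach (m.divisors ×ˢ n.divisors) (fun p => φ (p.1 * p.2))).trans
    (Finset.sum_product _ _ _)

theorem geom (q : ℚ) (hq : q ≠ 1) (χ : ℚ) (k : ℕ) :
    1 + ∑ j ∈ Finset.range k, q ^ j * (q - χ)
      = (q ^ (k + 1) - 1 - χ * (q ^ k - 1)) / (q - 1) := by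
  have : q - 1 ≠ 0 := sub_ne_zero.2 hq
  induction k with
  | zero => simp [this]
  | succ k ih =>
    rw [Finset.sum_range_succ, ← add_assoc, ih]
    field_simp
    ring

theorem fund_val {d : ℤ} (hfund : IsFundamentalDisc d) (q : ℕ) (hq : q.Prime) (F : ℕ)
    (hF : F ≠ 0) (N : ℕ) (hdF : -(N : ℤ) = d * (F : ℤ) ^ 2) (hN : 0 < N) :
    (N.factorization q - if q = 2 ∧ d % 4 = 0 then 2 else 0) / 2 = F.factorization q := by
  have hd0 : d.natAbs ≠ 0 := by
    intro h
    rw [Int.natAbs_eq_zero] at h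
    subst h
    simp at hdF; omega
  have hNe : N = d.natAbs * F ^ 2 := by
    have := congrArg Int.natAbs hdF
    simpa [Int.natAbs_mul, Int.natAbs_pow] using this
  have hfac : N.factorization q = d.natAbs.factorization q + 2 * F.factorization q := by
    rw [hNe, Nat.factorization_mul hd0 (pow_ne_zero _ hF), Nat.factorization_pow]
    simp
  rcases hfund with ⟨h1, hsq⟩ | ⟨h4, hsq, hmod⟩
  · have h2 := (Int.squarefree_natAbs.2 hsq).natFactorization_le_one q
    rw [if_neg (by omega)]
    omega
  · obtain ⟨m, rfl⟩ : ∃ m, d = 4 * m := ⟨d / 4, by omega⟩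
    have e : 4 * m / 4 = m := by omega
    rw [e] at hsq hmod
    have h2 := (Int.squarefree_natAbs.2 hsq).natFactorization_le_one q
    have hm0 : m.natAbs ≠ 0 := by omega
    have h3 : (4 * m).natAbs.factorization q
        = (if q = 2 then 2 else 0) + m.natAbs.factorization q := by
      rw [Int.natAbs_mul, Nat.factorization_mul (by norm_num) hm0]
      have : (4 : ℤ).natAbs = 2 ^ 2 := rfl
      rw [this, Nat.Prime.factorization_pow Nat.prime_two]
      simp [Finsupp.single_apply, eq_comm]
    by_cases hq2 : q = 2
    · rw [if_pos ⟨hq2, h4⟩]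
      rw [if_pos hq2] at h3
      omega
    · rw [if_neg (fun h => hq2 h.1)]
      rw [if_neg hq2] at h3
      omega

end HRed

/-- Reduction of the Hurwitz class number at a prime `q`:
with `μ_q = ord_q(N) - 2·δ_{q=2}·δ_{d ≡ 0 (4)}` and `k = ⌊μ_q/2⌋`,
`H(N) = H(N q^{-2k}) · (q^{k+1} - 1 - ((-N q^{-2k})/q)(q^k - 1))/(q - 1)`. -/
theorem hurwitz_reduce_at_prime (N : ℕ) (hN : 0 < N) (hmod : N % 4 = 0 ∨ N % 4 = 3)
    (d : ℤ) (F : ℕ) (hfund : IsFundamentalDisc d) (hdF : -(N : ℤ) = d * (F : ℤ) ^ 2)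
    (q : ℕ) (hq : q.Prime) (k : ℕ)
    (hk : k = (N.factorization q - if q = 2 ∧ d % 4 = 0 then 2 else 0) / 2) :
    hurwitz (N : ℚ) =
      hurwitz (((N / q ^ (2 * k) : ℕ) : ℚ)) *
        (((q : ℚ) ^ (k + 1) - 1 -
            (kroneckerSym (-(N : ℤ) / (q : ℤ) ^ (2 * k)) q : ℚ) * ((q : ℚ) ^ k - 1)) /
          ((q : ℚ) - 1)) := by
  have hF : F ≠ 0 := by
    rintro rfl
    simp at hdF; omega
  rw [HRed.fund_val hfund q hq F hF N hdF hN] at hk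
  have hF' : F = q ^ k * (F / q ^ k) := by
    rw [hk]; exact (Nat.ordProj_mul_ordCompl_eq_self F q).symm
  have hndvd : ¬ q ∣ F / q ^ k := by
    rw [hk]; exact Nat.not_dvd_ordCompl hq hF
  generalize F / q ^ k = G at hF' hndvd
  have hG : G ≠ 0 := by rintro rfl; simp at hndvd
  have hqpos : 0 < q := hq.pos
  have hd : d < 0 := by
    by_contra h
    have : 0 ≤ d * (F : ℤ) ^ 2 := mul_nonneg (by omega) (by positivity)
    omega
  have hqz : ((q : ℤ) ^ (2 * k)) ≠ 0 := by positivity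
  have hNq : -(N : ℤ) = (q : ℤ) ^ (2 * k) * (d * (G : ℤ) ^ 2) := by
    rw [hdF, hF']; push_cast; ring
  have hdvd : q ^ (2 * k) ∣ N := by
    have : ((q ^ (2 * k) : ℕ) : ℤ) ∣ (N : ℤ) := by
      rw [← dvd_neg, hNq]; push_cast; exact Dvd.intro _ rfl
    exact_mod_cast this
  obtain ⟨N', hN'⟩ := hdvd
  have hN'pos : 0 < N' := by
    rcases Nat.eq_zero_or_pos N' with h | h
    · subst h; simp at hN'; omega
    · exact h
  have hdiv : N / q ^ (2 * k) = N' := by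
    rw [hN', Nat.mul_div_cancel_left _ (by positivity)]
  have hdG : -(N' : ℤ) = d * (G : ℤ) ^ 2 := by
    apply mul_left_cancel₀ hqz
    rw [← hNq, hN']; push_cast; ring
  have hkr : -(N : ℤ) / (q : ℤ) ^ (2 * k) = d * (G : ℤ) ^ 2 := by
    rw [hNq, Int.mul_ediv_cancel_left _ hqz]
  have hcop : Nat.Coprime (q ^ k) G := ((Nat.Prime.coprime_iff_not_dvd hq).2 hndvd).pow_left k
  rw [hdiv, hkr, HRed.kron_sq q d G hq hndvd, HRed.hurwitz_sum hfund N F hN hdF,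
    HRed.hurwitz_sum hfund N' G hN'pos hdG, hF', HRed.sum_divisors_coprime hcop,
    Nat.sum_divisors_prime_pow hq, ← HRed.geom _ (by exact_mod_cast hq.one_lt.ne'),
    Finset.sum_range_succ', mul_add, mul_one, add_comm, Finset.mul_sum]
  congr 1
  · simp
  · refine Finset.sum_congr rfl fun j _ => ?_
    rw [Finset.sum_mul]
    refine Finset.sum_congr rfl fun g hg => ?_
    have hgd : g ∣ G := Nat.dvd_of_mem_divisors hg
    have hg0 : 0 < g := Nat.pos_of_mem_divisors hg
    have e : d * ((q ^ (j + 1) * g : ℕ) : ℤ) ^ 2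
        = d * (g : ℤ) ^ 2 * ((q ^ (j + 1) : ℕ) : ℤ) ^ 2 := by push_cast; ring
    rw [e, HRed.ms_pow q hq _ (mul_neg_of_neg_of_pos hd (by positivity))
      (HRed.mod4_sq _ _ (HRed.fund_mod hfund)), HRed.kron_sq q d g hq (fun h => hndvd (h.trans hgd))]
    ring
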